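/- There is an absolute constant K such that for all t ≥ 3 and all primes p ≤ t, |Σ_{n≤t} d(n)·α(pn)/n − (6/π²)·((1/90)·l⁶ + (1/30)·l⁵·log p)| ≤ K·(l⁵ + l⁶/p), where l = log t. -/

import Mathlib

/-- `α(n) = d^{(1,1)}(n) = Σ_{ab=n} (log a)(log b)`. -/
noncomputable def alphaFn (n : ℕ) : ℝ :=
  ∑ x ∈ n.divisorsAntidiagonal, Real.log x.1 * Real.log x.2

/-- The summatory function of `w` at `exp y` is `c * y ^ (k + 1) + O((1 + y) ^ k)`. -/
def HasLogMean (w : ℕ → ℝ) (c : ℝ) (k : ℕ) : Prop :=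
  ∃ K : ℝ, ∀ y : ℝ, 0 ≤ y →
    |∑ n ∈ Finset.Icc 1 ⌊Real.exp y⌋₊, w n - c * y ^ (k + 1)| ≤ K * (1 + y) ^ k

theorem mem_Icc_floor_exp {n : ℕ} {y : ℝ} :
    n ∈ Finset.Icc 1 ⌊Real.exp y⌋₊ ↔ 1 ≤ n ∧ Real.log n ≤ y := by
  rw [Finset.mem_Icc]
  refine and_congr_right fun hn ↦ ?_
  have h : (0 : ℝ) < n := by exact_mod_cast hn
  rw [Nat.le_floor_iff (Real.exp_pos y).le, Real.log_le_iff_le_exp h]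

theorem floor_exp_sub_log (y : ℝ) {a : ℕ} (ha : 1 ≤ a) :
    ⌊Real.exp (y - Real.log a)⌋₊ = ⌊Real.exp y⌋₊ / a := by
  have h : (0 : ℝ) < a := by exact_mod_cast ha
  rw [Real.exp_sub, Real.exp_log h, Nat.floor_div_natCast]

theorem intervalIntegrable_truncated_pow (L y : ℝ) (m : ℕ) :
    IntervalIntegrable (fun s ↦ if L ≤ s then (s - L) ^ m else 0) MeasureTheory.volume 0 y := by
  have h : IntervalIntegrable (fun s : ℝ ↦ (s - L) ^ m) MeasureTheory.volume 0 y :=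
    (by fun_prop : Continuous fun s : ℝ ↦ (s - L) ^ m).intervalIntegrable 0 y
  have h2 := h.1.indicator (measurableSet_Ici (a := L))
  have h3 := h.2.indicator (measurableSet_Ici (a := L))
  refine ⟨h2.congr ?_, h3.congr ?_⟩ <;>
  · refine Filter.Eventually.of_forall fun s ↦ ?_
    simp [Set.indicator_apply]

theorem integral_truncated_pow {L y : ℝ} (hL : 0 ≤ L) (hLy : L ≤ y) (m : ℕ) :
    ∫ s in (0 : ℝ)..y, (if L ≤ s then (s - L) ^ m else 0) = (y - L) ^ (m + 1) / (m + 1) := by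
  have hi := intervalIntegrable_truncated_pow L y m
  have h0y : Set.uIcc 0 y = Set.Icc 0 y := Set.uIcc_of_le (hL.trans hLy)
  rw [← intervalIntegral.integral_add_adjacent_intervals (b := L)
    (hi.mono_set (by rw [h0y, Set.uIcc_of_le hL]; exact Set.Icc_subset_Icc_right hLy))
    (hi.mono_set (by rw [h0y, Set.uIcc_of_le hLy]; exact Set.Icc_subset_Icc_left hL)),
    intervalIntegral.integral_congr_Ioo_of_le (g := fun _ ↦ (0 : ℝ)) hL
      (fun s hs ↦ if_neg (not_le.mpr hs.2)),
    intervalIntegral.integral_congr_Ioo_of_le (g := fun s ↦ (s - L) ^ m) hLy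
      (fun s hs ↦ if_pos hs.1.le),
    intervalIntegral.integral_comp_sub_right (fun s ↦ s ^ m) L]
  simp

/-- Integrating the Riesz mean of order `m` gives the Riesz mean of order `m + 1`. -/
theorem riesz_mean_succ (w : ℕ → ℝ) (m : ℕ) {y : ℝ} (hy : 0 ≤ y) :
    IntervalIntegrable (fun s ↦ ∑ n ∈ Finset.Icc 1 ⌊Real.exp s⌋₊, w n * (s - Real.log n) ^ m)
      MeasureTheory.volume 0 y ∧
    ∑ n ∈ Finset.Icc 1 ⌊Real.exp y⌋₊, w n * (y - Real.log n) ^ (m + 1) =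
      (m + 1) * ∫ s in (0 : ℝ)..y,
        ∑ n ∈ Finset.Icc 1 ⌊Real.exp s⌋₊, w n * (s - Real.log n) ^ m := by
  have key : ∀ s ∈ Set.uIcc 0 y,
      ∑ n ∈ Finset.Icc 1 ⌊Real.exp y⌋₊,
        w n * (if Real.log n ≤ s then (s - Real.log n) ^ m else 0) =
      ∑ n ∈ Finset.Icc 1 ⌊Real.exp s⌋₊, w n * (s - Real.log n) ^ m := by
    intro s hs
    rw [Set.uIcc_of_le hy] at hs
    have hsub : Finset.Icc 1 ⌊Real.exp s⌋₊ ⊆ Finset.Icc 1 ⌊Real.exp y⌋₊ :=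
      Finset.Icc_subset_Icc_right (Nat.floor_le_floor (Real.exp_le_exp.mpr hs.2))
    rw [← Finset.sum_subset hsub]
    · refine Finset.sum_congr rfl fun n hn ↦ ?_
      rw [if_pos (mem_Icc_floor_exp.mp hn).2]
    · intro n hn hn'
      rw [if_neg fun h ↦ hn' (mem_Icc_floor_exp.mpr ⟨(Finset.mem_Icc.mp hn).1, h⟩), mul_zero]
  have hint : ∀ n ∈ Finset.Icc 1 ⌊Real.exp y⌋₊, IntervalIntegrable
      (fun s ↦ w n * (if Real.log n ≤ s then (s - Real.log n) ^ m else 0))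
      MeasureTheory.volume 0 y :=
    fun n _ ↦ (intervalIntegrable_truncated_pow (Real.log n) y m).const_mul (w n)
  constructor
  · have h := IntervalIntegrable.sum _ hint
    refine h.congr fun s hs ↦ ?_
    have := key s (Set.uIoc_subset_uIcc hs)
    simpa using this
  · rw [← intervalIntegral.integral_congr key, intervalIntegral.integral_finsetSum hint,
      Finset.mul_sum]
    refine Finset.sum_congr rfl fun n hn ↦ ?_
    have h := mem_Icc_floor_exp.mp hn
    rw [intervalIntegral.integral_const_mul,
      integral_truncated_pow (Real.log_natCast_nonneg n) h.2]
    field_simp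

/-- The constant `∏_{i < m} (i + 1) / (k + i + 2)`. -/
noncomputable def rieszConst (k : ℕ) : ℕ → ℝ
  | 0 => 1
  | m + 1 => rieszConst k m * (m + 1) / (k + m + 2)

theorem HasLogMean.riesz {w : ℕ → ℝ} {c : ℝ} {k : ℕ} (hw : HasLogMean w c k) (m : ℕ) :
    ∃ K : ℝ, ∀ y : ℝ, 0 ≤ y →
      |∑ n ∈ Finset.Icc 1 ⌊Real.exp y⌋₊, w n * (y - Real.log n) ^ m -
        c * rieszConst k m * y ^ (k + m + 1)| ≤ K * (1 + y) ^ (k + m) := by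
  induction m with
  | zero => simpa [rieszConst, HasLogMean] using hw
  | succ m ih =>
    obtain ⟨K, hK⟩ := ih
    have hK0 : 0 ≤ K := by simpa using (abs_nonneg _).trans (hK 0 le_rfl)
    refine ⟨(m + 1) * K, fun y hy ↦ ?_⟩
    obtain ⟨hint, heq⟩ := riesz_mean_succ w m hy
    have hpow : c * rieszConst k (m + 1) * y ^ (k + (m + 1) + 1) =
        (m + 1) * ∫ s in (0 : ℝ)..y, c * rieszConst k m * s ^ (k + m + 1) := by
      rw [intervalIntegral.integral_const_mul, integral_pow, rieszConst]
      push_cast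
      have : (k : ℝ) + m + 2 ≠ 0 := by positivity
      have h2 : (k : ℝ) + m + 1 + 1 ≠ 0 := by positivity
      field_simp
      ring
    rw [heq, hpow, ← mul_sub, ← intervalIntegral.integral_sub hint
      ((by fun_prop : Continuous fun s : ℝ ↦
        c * rieszConst k m * s ^ (k + m + 1)).intervalIntegrable 0 y), abs_mul,
      abs_of_nonneg (by positivity : (0 : ℝ) ≤ m + 1), mul_assoc]
    refine mul_le_mul_of_nonneg_left ?_ (by positivity)
    have hb := intervalIntegral.norm_integral_le_of_norm_le_const (a := 0) (b := y)
      (f := fun s ↦ ∑ n ∈ Finset.Icc 1 ⌊Real.exp s⌋₊, w n * (s - Real.log n) ^ m -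
        c * rieszConst k m * s ^ (k + m + 1)) (C := K * (1 + y) ^ (k + m)) (by
      intro s hs
      rw [Set.uIoc_of_le hy] at hs
      refine (hK s hs.1.le).trans ?_
      have := hs.1.le
      have := hs.2
      gcongr)
    rw [Real.norm_eq_abs, sub_zero, abs_of_nonneg hy] at hb
    refine hb.trans ?_
    rw [← add_assoc, pow_succ, ← mul_assoc]
    gcongr
    linarith

/-- The sum of `f a b` over `a * b ≤ N`. -/
def hyperbolaSum (f : ℕ → ℕ → ℝ) (N : ℕ) : ℝ :=
  ∑ a ∈ Finset.Icc 1 N, ∑ b ∈ Finset.Icc 1 (N / a), f a b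

theorem HasLogMean.abs_sum_le {w : ℕ → ℝ} {c : ℝ} {k : ℕ} (hw : HasLogMean w c k) :
    ∃ K : ℝ, 0 ≤ K ∧ ∀ y : ℝ, 0 ≤ y →
      |∑ n ∈ Finset.Icc 1 ⌊Real.exp y⌋₊, w n| ≤ K * (1 + y) ^ (k + 1) := by
  obtain ⟨K, hK⟩ := hw
  have hK0 : 0 ≤ K := by simpa using (abs_nonneg _).trans (hK 0 le_rfl)
  refine ⟨K + |c|, by positivity, fun y hy ↦ ?_⟩
  have h1 := hK y hy
  have h2 : |c * y ^ (k + 1)| ≤ |c| * (1 + y) ^ (k + 1) := by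
    rw [abs_mul, abs_of_nonneg (pow_nonneg hy _)]
    gcongr
    linarith
  have h3 : K * (1 + y) ^ k ≤ K * (1 + y) ^ (k + 1) := by
    gcongr
    · linarith
    · omega
  have h4 := abs_sub_abs_le_abs_sub (∑ n ∈ Finset.Icc 1 ⌊Real.exp y⌋₊, w n) (c * y ^ (k + 1))
  linarith

theorem HasLogMean.hyperbolaSum {w v : ℕ → ℝ} {c d : ℝ} {k m : ℕ} (hw : HasLogMean w c k)
    (hw0 : ∀ n, 0 ≤ w n) (hv : HasLogMean v d m) :
    ∃ K : ℝ, ∀ y : ℝ, 0 ≤ y →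
      |hyperbolaSum (fun a b ↦ w a * v b) ⌊Real.exp y⌋₊ -
        c * d * rieszConst k (m + 1) * y ^ (k + m + 2)| ≤ K * (1 + y) ^ (k + m + 1) := by
  obtain ⟨K₁, hK₁⟩ := hw.riesz (m + 1)
  obtain ⟨K₂, hK₂0, hK₂⟩ := hw.abs_sum_le
  obtain ⟨K₃, hK₃⟩ := hv
  have hK₃0 : 0 ≤ K₃ := by simpa using (abs_nonneg _).trans (hK₃ 0 le_rfl)
  refine ⟨|d| * K₁ + K₂ * K₃, fun y hy ↦ ?_⟩
  set N := ⌊Real.exp y⌋₊ with hN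
  have hsplit : _root_.hyperbolaSum (fun a b ↦ w a * v b) N -
        c * d * rieszConst k (m + 1) * y ^ (k + m + 2) =
      ∑ a ∈ Finset.Icc 1 N, w a *
        (∑ b ∈ Finset.Icc 1 (N / a), v b - d * (y - Real.log a) ^ (m + 1)) +
      d * (∑ a ∈ Finset.Icc 1 N, w a * (y - Real.log a) ^ (m + 1) -
        c * rieszConst k (m + 1) * y ^ (k + (m + 1) + 1)) := by
    simp only [_root_.hyperbolaSum, mul_sub, Finset.sum_sub_distrib, Finset.mul_sum]
    have : ∀ a : ℕ, w a * (d * (y - Real.log a) ^ (m + 1)) =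
      d * (w a * (y - Real.log a) ^ (m + 1)) := fun a ↦ by ring
    simp only [this]
    ring
  rw [hsplit]
  refine (abs_add_le _ _).trans ?_
  have h1 : |∑ a ∈ Finset.Icc 1 N, w a *
      (∑ b ∈ Finset.Icc 1 (N / a), v b - d * (y - Real.log a) ^ (m + 1))| ≤
      K₂ * (1 + y) ^ (k + 1) * (K₃ * (1 + y) ^ m) := by
    refine (Finset.abs_sum_le_sum_abs _ _).trans ?_
    calc _ ≤ ∑ a ∈ Finset.Icc 1 N, w a * (K₃ * (1 + y) ^ m) := by
          refine Finset.sum_le_sum fun a ha ↦ ?_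
          rw [abs_mul, abs_of_nonneg (hw0 a)]
          refine mul_le_mul_of_nonneg_left ?_ (hw0 a)
          have ha' := mem_Icc_floor_exp.mp ha
          have := hK₃ (y - Real.log a) (by linarith)
          rw [floor_exp_sub_log y ha'.1] at this
          refine this.trans ?_
          have := Real.log_natCast_nonneg a
          have := ha'.2
          gcongr
          linarith
      _ ≤ _ := by
          rw [← Finset.sum_mul]
          exact mul_le_mul_of_nonneg_right ((le_abs_self _).trans (hK₂ y hy)) (by positivity)
  have h2 := mul_le_mul_of_nonneg_left (hK₁ y hy) (abs_nonneg d)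
  rw [abs_mul]
  refine (add_le_add h1 h2).trans (le_of_eq ?_)
  ring

theorem HasLogMean.mul_log {w : ℕ → ℝ} {c : ℝ} {k : ℕ} (hw : HasLogMean w c k) :
    HasLogMean (fun n ↦ w n * Real.log n) (c * (1 - rieszConst k 1)) (k + 1) := by
  obtain ⟨K₁, hK₁⟩ := hw.riesz 1
  obtain ⟨K, hK⟩ := hw
  have hK0 : 0 ≤ K := by simpa using (abs_nonneg _).trans (hK 0 le_rfl)
  refine ⟨K + K₁, fun y hy ↦ ?_⟩
  have hsplit : ∑ n ∈ Finset.Icc 1 ⌊Real.exp y⌋₊, w n * Real.log n -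
        c * (1 - rieszConst k 1) * y ^ (k + 1 + 1) =
      y * (∑ n ∈ Finset.Icc 1 ⌊Real.exp y⌋₊, w n - c * y ^ (k + 1)) -
      (∑ n ∈ Finset.Icc 1 ⌊Real.exp y⌋₊, w n * (y - Real.log n) ^ 1 -
        c * rieszConst k 1 * y ^ (k + 1 + 1)) := by
    simp only [pow_one, mul_sub, Finset.sum_sub_distrib, ← Finset.sum_mul]
    ring
  rw [hsplit]
  refine (abs_sub _ _).trans ?_
  rw [abs_mul, abs_of_nonneg hy, add_mul]
  refine add_le_add ?_ (hK₁ y hy)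
  calc y * _ ≤ (1 + y) * (K * (1 + y) ^ k) :=
        mul_le_mul (by linarith) (hK y hy) (abs_nonneg _) (by linarith)
    _ = _ := by ring

theorem hasLogMean_inv : HasLogMean (fun n ↦ (n : ℝ)⁻¹) 1 0 := by
  refine ⟨1, fun y hy ↦ ?_⟩
  have h1 := log_le_harmonic_floor (Real.exp y) (Real.exp_pos y).le
  have h2 := harmonic_floor_le_one_add_log (Real.exp y) (Real.one_le_exp hy)
  rw [Real.log_exp] at h1 h2
  rw [harmonic_eq_sum_Icc] at h1 h2
  push_cast at h1 h2
  rw [abs_le]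
  constructor <;> simp <;> linarith

theorem sum_divisorsAntidiagonal_eq_hyperbolaSum (f : ℕ → ℕ → ℝ) (N : ℕ) :
    ∑ n ∈ Finset.Icc 1 N, ∑ x ∈ n.divisorsAntidiagonal, f x.1 x.2 = hyperbolaSum f N := by
  rw [hyperbolaSum, Finset.sum_sigma', Finset.sum_sigma']
  refine Finset.sum_bij' (fun q _ ↦ ⟨q.2.1, q.2.2⟩) (fun q _ ↦ ⟨q.1 * q.2, (q.1, q.2)⟩)
    ?_ ?_ ?_ ?_ ?_
  · rintro ⟨n, a, b⟩ h
    simp only [Finset.mem_sigma, Finset.mem_Icc, Nat.mem_divisorsAntidiagonal] at h ⊢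
    obtain ⟨⟨h1, h2⟩, rfl, h3⟩ := h
    have ha : 0 < a := Nat.pos_of_ne_zero fun h ↦ by simp [h] at h3
    have hb : 0 < b := Nat.pos_of_ne_zero fun h ↦ by simp [h] at h3
    refine ⟨⟨ha, (Nat.le_mul_of_pos_right a hb).trans h2⟩, hb, ?_⟩
    rw [Nat.le_div_iff_mul_le ha, mul_comm]
    exact h2
  · rintro ⟨a, b⟩ h
    simp only [Finset.mem_sigma, Finset.mem_Icc, Nat.mem_divisorsAntidiagonal] at h ⊢
    obtain ⟨⟨h1, h2⟩, h3, h4⟩ := h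
    rw [Nat.le_div_iff_mul_le h1, mul_comm] at h4
    have : 0 < a * b := Nat.mul_pos h1 h3
    exact ⟨⟨this, h4⟩, trivial, this.ne'⟩
  · rintro ⟨n, a, b⟩ h
    simp only [Finset.mem_sigma, Finset.mem_Icc, Nat.mem_divisorsAntidiagonal] at h
    obtain ⟨_, rfl, _⟩ := h
    rfl
  · rintro ⟨a, b⟩ _
    rfl
  · rintro ⟨n, a, b⟩ _
    rfl

theorem card_divisors_mul_eq_card_filter {a b : ℕ} (ha : a ≠ 0) (hb : b ≠ 0) :
    (a * b).divisors.card =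
      ((a.divisorsAntidiagonal ×ˢ b.divisorsAntidiagonal).filter
        fun q ↦ Nat.gcd q.1.2 q.2.1 = 1).card := by
  refine Finset.card_bij'
    (fun c _ ↦ ((a.gcd c, a / a.gcd c), (c / a.gcd c, b / (c / a.gcd c))))
    (fun q _ ↦ q.1.1 * q.2.1) ?_ ?_ ?_ ?_
  · intro c hc
    have hc' := (Nat.mem_divisors.mp hc).1
    have hg : 0 < a.gcd c := Nat.gcd_pos_of_pos_left c (Nat.pos_of_ne_zero ha)
    have hco : Nat.Coprime (a / a.gcd c) (c / a.gcd c) := Nat.coprime_div_gcd_div_gcd hg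
    have hdvd : c / a.gcd c ∣ b := by
      refine hco.symm.dvd_of_dvd_mul_left ?_
      refine Nat.dvd_of_mul_dvd_mul_left hg ?_
      rw [Nat.mul_div_cancel' (Nat.gcd_dvd_right a c), ← mul_assoc,
        Nat.mul_div_cancel' (Nat.gcd_dvd_left a c)]
      exact hc'
    simp only [Finset.mem_filter, Finset.mem_product, Nat.mem_divisorsAntidiagonal]
    exact ⟨⟨⟨Nat.mul_div_cancel' (Nat.gcd_dvd_left a c), ha⟩, Nat.mul_div_cancel' hdvd, hb⟩, hco⟩
  · rintro ⟨⟨r, s⟩, t, u⟩ h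
    simp only [Finset.mem_filter, Finset.mem_product, Nat.mem_divisorsAntidiagonal] at h
    obtain ⟨⟨⟨rfl, _⟩, rfl, _⟩, _⟩ := h
    exact Nat.mem_divisors.mpr
      ⟨mul_dvd_mul (dvd_mul_right r s) (dvd_mul_right t u), mul_ne_zero ha hb⟩
  · intro c _
    exact Nat.mul_div_cancel' (Nat.gcd_dvd_right a c)
  · rintro ⟨⟨r, s⟩, t, u⟩ h
    simp only [Finset.mem_filter, Finset.mem_product, Nat.mem_divisorsAntidiagonal] at h
    obtain ⟨⟨⟨rfl, _⟩, rfl, _⟩, hg⟩ := h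
    have hr : 0 < r := Nat.pos_of_ne_zero (left_ne_zero_of_mul ha)
    have ht : 0 < t := Nat.pos_of_ne_zero (left_ne_zero_of_mul hb)
    simp [Nat.gcd_mul_left, hg, hr, ht]

theorem card_divisors_mul_le {a b : ℕ} (ha : a ≠ 0) (hb : b ≠ 0) :
    (a * b).divisors.card ≤ a.divisors.card * b.divisors.card := by
  rw [card_divisors_mul_eq_card_filter ha hb]
  refine (Finset.card_filter_le _ _).trans (le_of_eq ?_)
  rw [Finset.card_product, ← Nat.map_div_right_divisors, ← Nat.map_div_right_divisors,
    Finset.card_map, Finset.card_map]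

theorem card_filter_dvd_snd_divisorsAntidiagonal {a e : ℕ} (ha : a ≠ 0) (he : e ∣ a) :
    (a.divisorsAntidiagonal.filter fun x ↦ e ∣ x.2).card = (a / e).divisors.card := by
  obtain ⟨m, rfl⟩ := he
  have he0 : 0 < e := Nat.pos_of_ne_zero (left_ne_zero_of_mul ha)
  have hm0 : m ≠ 0 := right_ne_zero_of_mul ha
  rw [Nat.mul_div_cancel_left m he0]
  refine Finset.card_bij' (fun x _ ↦ x.1) (fun r _ ↦ (r, e * (m / r))) ?_ ?_ ?_ ?_
  · rintro ⟨r, s⟩ h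
    simp only [Finset.mem_filter, Nat.mem_divisorsAntidiagonal] at h
    obtain ⟨⟨h1, _⟩, u, rfl⟩ := h
    rw [Nat.mem_divisors]
    refine ⟨⟨u, ?_⟩, hm0⟩
    refine Nat.eq_of_mul_eq_mul_left he0 ?_
    rw [← h1]
    ring
  · intro r hr
    have hr' := (Nat.mem_divisors.mp hr).1
    simp only [Finset.mem_filter, Nat.mem_divisorsAntidiagonal]
    refine ⟨⟨?_, ha⟩, dvd_mul_right _ _⟩
    rw [mul_left_comm, Nat.mul_div_cancel' hr']
  · rintro ⟨r, s⟩ h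
    simp only [Finset.mem_filter, Nat.mem_divisorsAntidiagonal] at h
    obtain ⟨⟨h1, _⟩, u, rfl⟩ := h
    have hr : 0 < r := Nat.pos_of_ne_zero (left_ne_zero_of_mul (h1 ▸ ha))
    have : m = r * u := by
      refine Nat.eq_of_mul_eq_mul_left he0 ?_
      rw [← h1]
      ring
    simp [this, hr]
  · intro r _
    rfl

theorem card_filter_dvd_fst_divisorsAntidiagonal {a e : ℕ} (ha : a ≠ 0) (he : e ∣ a) :
    (a.divisorsAntidiagonal.filter fun x ↦ e ∣ x.1).card = (a / e).divisors.card := by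
  rw [← card_filter_dvd_snd_divisorsAntidiagonal ha he]
  refine Finset.card_bij' (fun x _ ↦ x.swap) (fun x _ ↦ x.swap) ?_ ?_ ?_ ?_
  · simp +contextual
  · simp +contextual
  · simp
  · simp

theorem sum_divisors_moebius_eq_ite {n : ℕ} :
    ∑ e ∈ n.divisors, (ArithmeticFunction.moebius e : ℝ) = if n = 1 then 1 else 0 := by
  have h := congrArg (fun f : ArithmeticFunction ℤ ↦ f n)
    ArithmeticFunction.coe_zeta_mul_moebius
  simp only [ArithmeticFunction.coe_zeta_mul_apply, ArithmeticFunction.one_apply] at h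
  exact_mod_cast h

/-- The Hecke-type relation `d(ab) = ∑_{e ∣ gcd(a, b)} μ(e) d(a/e) d(b/e)`. -/
theorem card_divisors_mul_eq_sum_moebius {a b : ℕ} (ha : a ≠ 0) (hb : b ≠ 0) :
    ((a * b).divisors.card : ℝ) = ∑ e ∈ (a.gcd b).divisors,
      (ArithmeticFunction.moebius e : ℝ) * ((a / e).divisors.card * (b / e).divisors.card) := by
  have h1 : ((a * b).divisors.card : ℝ) =
      ∑ q ∈ a.divisorsAntidiagonal ×ˢ b.divisorsAntidiagonal,
        ∑ e ∈ (a.gcd b).divisors,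
          if e ∣ q.1.2 ∧ e ∣ q.2.1 then (ArithmeticFunction.moebius e : ℝ) else 0 := by
    rw [card_divisors_mul_eq_card_filter ha hb, Finset.card_filter]
    push_cast
    refine Finset.sum_congr rfl fun q hq ↦ ?_
    rw [← sum_divisors_moebius_eq_ite, ← Finset.sum_filter]
    refine Finset.sum_congr ?_ fun _ _ ↦ rfl
    simp only [Finset.mem_product, Nat.mem_divisorsAntidiagonal] at hq
    obtain ⟨⟨h1, _⟩, h2, _⟩ := hq
    ext e
    have hs : q.1.2 ≠ 0 := fun h ↦ ha (by rw [← h1, h, mul_zero])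
    simp only [Nat.mem_divisors, Finset.mem_filter, Nat.dvd_gcd_iff, ne_eq, Nat.gcd_eq_zero_iff,
      ha, hs, false_and, not_false_eq_true, and_true]
    exact ⟨fun h ↦ ⟨⟨h1 ▸ h.1.mul_left _, h2 ▸ h.2.mul_right _⟩, h⟩, fun h ↦ h.2⟩
  rw [h1, Finset.sum_comm]
  refine Finset.sum_congr rfl fun e he ↦ ?_
  have he' := Nat.dvd_gcd_iff.mp (Nat.mem_divisors.mp he).1
  rw [← card_filter_dvd_snd_divisorsAntidiagonal ha he'.1,
    ← card_filter_dvd_fst_divisorsAntidiagonal hb he'.2, ← Finset.sum_filter, Finset.sum_const,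
    nsmul_eq_mul, mul_comm, ← Nat.cast_mul, ← Finset.card_product,
    ← Finset.filter_product (fun x : ℕ × ℕ ↦ e ∣ x.2) (fun x : ℕ × ℕ ↦ e ∣ x.1)]

theorem hyperbolaSum_card_divisors_mul (f : ℕ → ℕ → ℝ) (N : ℕ) :
    hyperbolaSum (fun a b ↦ ((a * b).divisors.card : ℝ) * f a b) N =
      ∑ e ∈ Finset.Icc 1 N, (ArithmeticFunction.moebius e : ℝ) *
        hyperbolaSum (fun a b ↦ a.divisors.card * b.divisors.card * f (e * a) (e * b))
          (N / (e * e)) := by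
  have h1 : hyperbolaSum (fun a b ↦ ((a * b).divisors.card : ℝ) * f a b) N =
      ∑ a ∈ Finset.Icc 1 N, ∑ b ∈ Finset.Icc 1 (N / a), ∑ e ∈ (a.gcd b).divisors,
        (ArithmeticFunction.moebius e : ℝ) *
          ((a / e).divisors.card * (b / e).divisors.card * f a b) := by
    refine Finset.sum_congr rfl fun a ha ↦ Finset.sum_congr rfl fun b hb ↦ ?_
    have ha' : a ≠ 0 := Nat.ne_zero_of_lt (Finset.mem_Icc.mp ha).1
    have hb' : b ≠ 0 := Nat.ne_zero_of_lt (Finset.mem_Icc.mp hb).1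
    simp only
    rw [card_divisors_mul_eq_sum_moebius ha' hb', Finset.sum_mul]
    exact Finset.sum_congr rfl fun e _ ↦ by ring
  rw [h1]
  simp only [hyperbolaSum, Finset.mul_sum, Finset.sum_sigma']
  refine Finset.sum_bij' (fun q _ ↦ ⟨q.2.2, q.1 / q.2.2, q.2.1 / q.2.2⟩)
    (fun q _ ↦ ⟨q.1 * q.2.1, q.1 * q.2.2, q.1⟩) ?_ ?_ ?_ ?_ ?_
  · rintro ⟨a, b, e⟩ h
    simp only [Finset.mem_sigma, Finset.mem_Icc, Nat.mem_divisors, Nat.dvd_gcd_iff] at h ⊢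
    obtain ⟨⟨ha, haN⟩, ⟨hb, hbN⟩, ⟨⟨u, rfl⟩, ⟨v, rfl⟩⟩, -⟩ := h
    have he : 0 < e := Nat.pos_of_mul_pos_right ha
    have hu : 0 < u := Nat.pos_of_mul_pos_left ha
    have hv : 0 < v := Nat.pos_of_mul_pos_left hb
    rw [Nat.le_div_iff_mul_le ha] at hbN
    rw [Nat.mul_div_cancel_left u he, Nat.mul_div_cancel_left v he]
    refine ⟨⟨he, ?_⟩, ⟨hu, ?_⟩, hv, ?_⟩
    · exact (Nat.le_mul_of_pos_right e hu).trans haN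
    · rw [Nat.le_div_iff_mul_le (Nat.mul_pos he he)]
      nlinarith [Nat.mul_pos he he, Nat.mul_pos (Nat.mul_pos he he) hu]
    · rw [Nat.le_div_iff_mul_le hu, Nat.le_div_iff_mul_le (Nat.mul_pos he he)]
      linarith
  · rintro ⟨e, u, v⟩ h
    simp only [Finset.mem_sigma, Finset.mem_Icc, Nat.mem_divisors, Nat.dvd_gcd_iff] at h ⊢
    obtain ⟨⟨he, heN⟩, ⟨hu, huN⟩, hv, hvN⟩ := h
    rw [Nat.le_div_iff_mul_le hu, Nat.le_div_iff_mul_le (Nat.mul_pos he he)] at hvN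
    rw [Nat.le_div_iff_mul_le (Nat.mul_pos he he)] at huN
    have heu := Nat.mul_pos he hu
    have hev := Nat.mul_pos he hv
    refine ⟨⟨heu, ?_⟩, ⟨hev, ?_⟩, ⟨dvd_mul_right _ _, dvd_mul_right _ _⟩, ?_⟩
    · nlinarith
    · rw [Nat.le_div_iff_mul_le heu]
      linarith
    · exact (Nat.gcd_pos_of_pos_left _ heu).ne'
  · rintro ⟨a, b, e⟩ h
    simp only [Finset.mem_sigma, Finset.mem_Icc, Nat.mem_divisors, Nat.dvd_gcd_iff] at h
    obtain ⟨_, _, ⟨h1, h2⟩, -⟩ := h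
    simp [Nat.mul_div_cancel' h1, Nat.mul_div_cancel' h2]
  · rintro ⟨e, u, v⟩ h
    simp only [Finset.mem_sigma, Finset.mem_Icc] at h
    have he : 0 < e := h.1.1
    simp [he]
  · rintro ⟨a, b, e⟩ h
    simp only [Finset.mem_sigma, Finset.mem_Icc, Nat.mem_divisors, Nat.dvd_gcd_iff] at h
    obtain ⟨_, _, ⟨h1, h2⟩, -⟩ := h
    simp [Nat.mul_div_cancel' h1, Nat.mul_div_cancel' h2]

theorem alphaFn_prime_mul {p n : ℕ} (hp : p.Prime) (hpn : ¬ p ∣ n) :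
    alphaFn (p * n) = ∑ x ∈ n.divisorsAntidiagonal,
      (2 * (Real.log x.1 * Real.log x.2) + Real.log p * (Real.log x.1 + Real.log x.2)) := by
  have hn : n ≠ 0 := fun h ↦ hpn (h ▸ dvd_zero p)
  have hpr : (p : ℝ) ≠ 0 := by exact_mod_cast hp.ne_zero
  have hlog : ∀ x ∈ n.divisorsAntidiagonal, (x.1 : ℝ) ≠ 0 ∧ (x.2 : ℝ) ≠ 0 := fun x hx ↦ by
    have := Nat.ne_zero_of_mem_divisorsAntidiagonal hx
    exact_mod_cast this
  have h1 : ∑ x ∈ (p * n).divisorsAntidiagonal with p ∣ x.1, Real.log x.1 * Real.log x.2 =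
      ∑ x ∈ n.divisorsAntidiagonal, (Real.log p + Real.log x.1) * Real.log x.2 := by
    symm
    refine Finset.sum_bij' (fun x _ ↦ (p * x.1, x.2)) (fun x _ ↦ (x.1 / p, x.2)) ?_ ?_ ?_ ?_ ?_
    · rintro ⟨a, b⟩ h
      simp only [Finset.mem_filter, Nat.mem_divisorsAntidiagonal] at h ⊢
      exact ⟨⟨by rw [mul_assoc, h.1], mul_ne_zero hp.ne_zero hn⟩, dvd_mul_right _ _⟩
    · rintro ⟨a, b⟩ h
      simp only [Finset.mem_filter, Nat.mem_divisorsAntidiagonal] at h ⊢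
      obtain ⟨⟨h1, -⟩, u, rfl⟩ := h
      rw [Nat.mul_div_cancel_left u hp.pos]
      exact ⟨Nat.eq_of_mul_eq_mul_left hp.pos (by rw [← h1, mul_assoc]), hn⟩
    · rintro ⟨a, b⟩ h
      simp [hp.pos]
    · rintro ⟨a, b⟩ h
      simp only [Finset.mem_filter] at h
      simp [Nat.mul_div_cancel' h.2]
    · rintro ⟨a, b⟩ h
      simp [Real.log_mul hpr (hlog _ h).1]
  have h2 : ∑ x ∈ (p * n).divisorsAntidiagonal with ¬ p ∣ x.1, Real.log x.1 * Real.log x.2 =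
      ∑ x ∈ n.divisorsAntidiagonal, Real.log x.1 * (Real.log p + Real.log x.2) := by
    symm
    have hdvd : ∀ a b : ℕ, a * b = p * n → ¬ p ∣ a → p ∣ b := fun a b h ha ↦
      (hp.dvd_mul.mp (h ▸ dvd_mul_right p n)).resolve_left ha
    refine Finset.sum_bij' (fun x _ ↦ (x.1, p * x.2)) (fun x _ ↦ (x.1, x.2 / p)) ?_ ?_ ?_ ?_ ?_
    · rintro ⟨a, b⟩ h
      simp only [Finset.mem_filter, Nat.mem_divisorsAntidiagonal] at h ⊢
      exact ⟨⟨by rw [mul_left_comm, h.1], mul_ne_zero hp.ne_zero hn⟩,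
        fun hpa ↦ hpn (h.1 ▸ hpa.mul_right b)⟩
    · rintro ⟨a, b⟩ h
      simp only [Finset.mem_filter, Nat.mem_divisorsAntidiagonal] at h ⊢
      obtain ⟨⟨h1, -⟩, h2⟩ := h
      obtain ⟨u, rfl⟩ := hdvd a b h1 h2
      rw [Nat.mul_div_cancel_left u hp.pos]
      exact ⟨Nat.eq_of_mul_eq_mul_left hp.pos (by rw [← h1]; ring), hn⟩
    · rintro ⟨a, b⟩ h
      simp [hp.pos]
    · rintro ⟨a, b⟩ h
      simp only [Finset.mem_filter, Nat.mem_divisorsAntidiagonal] at h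
      simp [Nat.mul_div_cancel' (hdvd a b h.1.1 h.2)]
    · rintro ⟨a, b⟩ h
      simp [Real.log_mul hpr (hlog _ h).2]
  rw [alphaFn, ← Finset.sum_filter_add_sum_filter_not _ (fun x ↦ p ∣ x.1), h1, h2,
    ← Finset.sum_add_distrib]
  exact Finset.sum_congr rfl fun x _ ↦ by ring

theorem log_mem_Icc_of_dvd {a n : ℕ} (hn : n ≠ 0) (h : a ∣ n) :
    0 ≤ Real.log a ∧ Real.log a ≤ Real.log n := by
  refine ⟨Real.log_natCast_nonneg a, Real.log_le_log ?_ ?_⟩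
  · exact_mod_cast Nat.pos_of_ne_zero fun h0 ↦ hn (by simpa [h0] using h)
  · exact_mod_cast Nat.le_of_dvd (Nat.pos_of_ne_zero hn) h

theorem card_divisorsAntidiagonal_eq (n : ℕ) :
    n.divisorsAntidiagonal.card = n.divisors.card := by
  rw [← Nat.map_div_right_divisors, Finset.card_map]

theorem alphaFn_nonneg (n : ℕ) : 0 ≤ alphaFn n :=
  Finset.sum_nonneg fun x _ ↦
    mul_nonneg (Real.log_natCast_nonneg x.1) (Real.log_natCast_nonneg x.2)

theorem alphaFn_le {n : ℕ} (hn : n ≠ 0) :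
    alphaFn n ≤ n.divisors.card * Real.log n ^ 2 := by
  rw [← card_divisorsAntidiagonal_eq, ← nsmul_eq_mul]
  refine Finset.sum_le_card_nsmul _ _ _ fun x hx ↦ ?_
  have h := (Nat.mem_divisorsAntidiagonal.mp hx).1
  have h1 := log_mem_Icc_of_dvd hn (h ▸ dvd_mul_right x.1 x.2)
  have h2 := log_mem_Icc_of_dvd hn (h ▸ dvd_mul_left x.2 x.1)
  rw [sq]
  exact mul_le_mul h1.2 h2.2 h2.1 (h1.1.trans h1.2)

theorem summable_one_add_log_sq_div_sq :
    Summable fun e : ℕ ↦ (1 + Real.log e) ^ 2 / (e : ℝ) ^ 2 := by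
  have hs : Summable fun e : ℕ ↦ 25 * (1 / (e : ℝ) ^ (3 / 2 : ℝ)) :=
    (Real.summable_one_div_nat_rpow.mpr (by norm_num)).mul_left 25
  refine Summable.of_nonneg_of_le (fun e ↦ by positivity) (fun e ↦ ?_) hs
  rcases Nat.eq_zero_or_pos e with rfl | he
  · simp
  have he1 : (1 : ℝ) ≤ e := by exact_mod_cast he
  have he0 : (0 : ℝ) < e := by linarith
  have h1 : Real.log e ≤ (e : ℝ) ^ (1 / 4 : ℝ) / (1 / 4) :=
    Real.log_le_rpow_div he0.le (by norm_num)
  have h2 : 1 ≤ (e : ℝ) ^ (1 / 4 : ℝ) := Real.one_le_rpow he1 (by norm_num)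
  have h3 := Real.log_nonneg he1
  have h4 : (1 + Real.log e) ^ 2 ≤ (5 * (e : ℝ) ^ (1 / 4 : ℝ)) ^ 2 := by
    gcongr
    linarith
  have h5 : ((e : ℝ) ^ (1 / 4 : ℝ)) ^ 2 * (e : ℝ) ^ (3 / 2 : ℝ) = (e : ℝ) ^ 2 := by
    rw [← Real.rpow_natCast, ← Real.rpow_natCast, ← Real.rpow_mul he0.le, ← Real.rpow_add he0]
    norm_num
  rw [mul_one_div, div_le_div_iff₀ (by positivity) (by positivity), ← h5]
  calc _ ≤ (5 * (e : ℝ) ^ (1 / 4 : ℝ)) ^ 2 * (e : ℝ) ^ (3 / 2 : ℝ) := by gcongr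
    _ = _ := by ring

theorem abs_moebius_cast_le_one (e : ℕ) : |(ArithmeticFunction.moebius e : ℝ)| ≤ 1 := by
  exact_mod_cast ArithmeticFunction.abs_moebius_le_one

theorem summable_moebius_div_sq :
    Summable fun e : ℕ ↦ (ArithmeticFunction.moebius e : ℝ) / (e : ℝ) ^ 2 := by
  refine Summable.of_norm_bounded (Real.summable_one_div_nat_pow.mpr one_lt_two) fun e ↦ ?_
  rw [norm_div, Real.norm_eq_abs, norm_pow, Real.norm_natCast]
  gcongr
  exact abs_moebius_cast_le_one e

theorem tsum_moebius_div_sq :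
    ∑' e : ℕ, (ArithmeticFunction.moebius e : ℝ) / (e : ℝ) ^ 2 = 6 / Real.pi ^ 2 := by
  have h := ArithmeticFunction.LSeries_zeta_mul_Lseries_moebius (s := 2) (by norm_num)
  rw [ArithmeticFunction.LSeries_zeta_eq_riemannZeta (by norm_num), riemannZeta_two] at h
  have h2 : LSeries (fun n ↦ ((ArithmeticFunction.moebius n : ℤ) : ℂ)) 2 =
      ((∑' e : ℕ, (ArithmeticFunction.moebius e : ℝ) / (e : ℝ) ^ 2 : ℝ) : ℂ) := by
    rw [LSeries, Complex.ofReal_tsum]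
    refine tsum_congr fun e ↦ ?_
    rw [LSeries.term_def]
    split_ifs with he
    · simp [he]
    · push_cast
      norm_cast
  rw [h2] at h
  have h3 : Real.pi ^ 2 / 6 *
      ∑' e : ℕ, (ArithmeticFunction.moebius e : ℝ) / (e : ℝ) ^ 2 = 1 := by exact_mod_cast h
  have := Real.pi_ne_zero
  field_simp at h3 ⊢
  linarith

/-- A sum of `μ(e) / e²` against quantities depending on `x / e²` polynomially in the logarithm. -/
theorem sum_moebius_div_sq_mul {H : ℕ → ℕ → ℝ} {D K : ℝ} {j : ℕ} (hH0 : ∀ e, H e 0 = 0)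
    (hH : ∀ e : ℕ, 1 ≤ e → ∀ z : ℝ, 0 ≤ z →
      |H e ⌊Real.exp z⌋₊ - D * z ^ (j + 1)| ≤ K * (1 + Real.log e) ^ 2 * (1 + z) ^ j) :
    ∃ K' : ℝ, ∀ y : ℝ, 0 ≤ y →
      |∑ e ∈ Finset.Icc 1 ⌊Real.exp y⌋₊, (ArithmeticFunction.moebius e : ℝ) / (e : ℝ) ^ 2 *
          H e (⌊Real.exp y⌋₊ / (e * e)) - 6 / Real.pi ^ 2 * D * y ^ (j + 1)| ≤
        K' * (1 + y) ^ j := by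
  have hK0 : 0 ≤ K := by simpa using (abs_nonneg _).trans (hH 1 le_rfl 0 le_rfl)
  set C := K + |D| * (2 * (j + 1)) with hC
  have hC0 : 0 ≤ C := by positivity
  refine ⟨C * ∑' e : ℕ, (1 + Real.log e) ^ 2 / (e : ℝ) ^ 2, fun y hy ↦ ?_⟩
  set N := ⌊Real.exp y⌋₊ with hN
  have key : ∀ e : ℕ, 1 ≤ e → |H e (N / (e * e)) - D * y ^ (j + 1)| ≤
      C * (1 + Real.log e) ^ 2 * (1 + y) ^ j := by
    intro e he
    have hlog := Real.log_natCast_nonneg e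
    have he0 : (e : ℝ) ≠ 0 := by positivity
    have hee : 1 ≤ e * e := Nat.mul_pos he he
    have hll : Real.log ((e * e : ℕ) : ℝ) = 2 * Real.log e := by
      push_cast
      rw [Real.log_mul he0 he0]
      ring
    have hb : |D| * (2 * Real.log e * (j + 1) * y ^ j) ≤
        |D| * (2 * (j + 1)) * (1 + Real.log e) ^ 2 * (1 + y) ^ j := by
      have h1 : Real.log e ≤ (1 + Real.log e) ^ 2 := by nlinarith
      have h2 : y ^ j ≤ (1 + y) ^ j := by
        gcongr
        linarith
      calc _ = |D| * (2 * (j + 1)) * Real.log e * y ^ j := by ring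
        _ ≤ _ := by gcongr
    by_cases hey : 2 * Real.log e ≤ y
    · have h1 := hH e he (y - 2 * Real.log e) (by linarith)
      rw [← hll, floor_exp_sub_log y hee, hll] at h1
      have h2 : K * (1 + Real.log e) ^ 2 * (1 + (y - 2 * Real.log e)) ^ j ≤
          K * (1 + Real.log e) ^ 2 * (1 + y) ^ j := by
        gcongr
        linarith
      have h3 := abs_pow_sub_pow_le (y - 2 * Real.log e) y (j + 1)
      have h4 : |(y - 2 * Real.log e) - y| = 2 * Real.log e := by
        rw [sub_sub_cancel_left, abs_neg, abs_of_nonneg (by positivity)]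
      have h5 : max |y - 2 * Real.log e| |y| = y := by
        rw [abs_of_nonneg hy, abs_of_nonneg (by linarith)]
        exact max_eq_right (by linarith)
      rw [h4, h5, Nat.add_sub_cancel] at h3
      push_cast at h3
      have h6 := mul_le_mul_of_nonneg_left h3 (abs_nonneg D)
      rw [← abs_mul] at h6
      calc _ = |(H e (N / (e * e)) - D * (y - 2 * Real.log e) ^ (j + 1)) +
            D * ((y - 2 * Real.log e) ^ (j + 1) - y ^ (j + 1))| := by
            congr 1
            ring
        _ ≤ _ := abs_add_le _ _
        _ ≤ _ := by
            rw [hC, add_mul, add_mul]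
            linarith
    · push Not at hey
      have h1 : N / (e * e) = 0 := by
        have h2 : ¬ (e * e ∈ Finset.Icc 1 N) := fun h ↦ by
          have := (mem_Icc_floor_exp.mp h).2
          rw [hll] at this
          linarith
        rw [Finset.mem_Icc] at h2
        exact Nat.div_eq_of_lt (by omega)
      rw [h1, hH0, zero_sub, abs_neg, abs_mul, abs_of_nonneg (pow_nonneg hy _)]
      have h3 : y ^ (j + 1) ≤ 2 * Real.log e * (j + 1) * y ^ j := by
        have h4 : 0 ≤ 2 * Real.log e * j * y ^ j := by positivity
        have h5 : y * y ^ j ≤ 2 * Real.log e * y ^ j := by gcongr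
        rw [pow_succ]
        linarith
      have h6 := mul_le_mul_of_nonneg_left h3 (abs_nonneg D)
      have h7 : 0 ≤ K * (1 + Real.log e) ^ 2 * (1 + y) ^ j := by positivity
      rw [hC, add_mul, add_mul]
      linarith
  have hsupp : ∀ e ∉ Finset.Icc 1 N, (ArithmeticFunction.moebius e : ℝ) / (e : ℝ) ^ 2 *
      H e (N / (e * e)) = 0 := by
    intro e he
    rcases Nat.eq_zero_or_pos e with rfl | he0
    · simp
    · rw [Finset.mem_Icc] at he
      have : N / (e * e) = 0 := Nat.div_eq_of_lt
        ((by omega : N < e).trans_le (Nat.le_mul_of_pos_right e he0))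
      rw [this, hH0, mul_zero]
  have hsum1 : HasSum (fun e : ℕ ↦ (ArithmeticFunction.moebius e : ℝ) / (e : ℝ) ^ 2 *
      H e (N / (e * e))) _ := hasSum_sum_of_ne_finset_zero hsupp
  have hsum2 := (tsum_moebius_div_sq ▸ summable_moebius_div_sq.hasSum).mul_right (D * y ^ (j + 1))
  have hsum := hsum1.sub hsum2
  have hbd := (summable_one_add_log_sq_div_sq.hasSum.mul_left (C * (1 + y) ^ j))
  rw [mul_assoc (6 / Real.pi ^ 2), ← hsum.tsum_eq, mul_right_comm,
    ← Real.norm_eq_abs]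
  refine tsum_of_norm_bounded hbd fun e ↦ ?_
  rw [← mul_sub, norm_mul, norm_div, norm_pow, Real.norm_eq_abs, Real.norm_eq_abs,
    Real.norm_eq_abs, Nat.abs_cast]
  rcases Nat.eq_zero_or_pos e with rfl | he
  · simp
  have he0 : (0 : ℝ) < e := by exact_mod_cast he
  have h1 := abs_moebius_cast_le_one e
  have h2 := key e he
  calc _ ≤ 1 / (e : ℝ) ^ 2 * (C * (1 + Real.log e) ^ 2 * (1 + y) ^ j) := by gcongr
    _ = _ := by ring

theorem hyperbolaSum_congr {f g : ℕ → ℕ → ℝ} (N : ℕ)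
    (h : ∀ a b : ℕ, 1 ≤ a → 1 ≤ b → f a b = g a b) : hyperbolaSum f N = hyperbolaSum g N :=
  Finset.sum_congr rfl fun a ha ↦ Finset.sum_congr rfl fun b hb ↦
    h a b (Finset.mem_Icc.mp ha).1 (Finset.mem_Icc.mp hb).1

theorem hyperbolaSum_mono {f g : ℕ → ℕ → ℝ} (N : ℕ)
    (h : ∀ a b : ℕ, 1 ≤ a → 1 ≤ b → f a b ≤ g a b) : hyperbolaSum f N ≤ hyperbolaSum g N :=
  Finset.sum_le_sum fun a ha ↦ Finset.sum_le_sum fun b hb ↦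
    h a b (Finset.mem_Icc.mp ha).1 (Finset.mem_Icc.mp hb).1

theorem hyperbolaSum_add (f g : ℕ → ℕ → ℝ) (N : ℕ) :
    hyperbolaSum (fun a b ↦ f a b + g a b) N = hyperbolaSum f N + hyperbolaSum g N := by
  simp [hyperbolaSum, Finset.sum_add_distrib]

theorem hyperbolaSum_const_mul (c : ℝ) (f : ℕ → ℕ → ℝ) (N : ℕ) :
    hyperbolaSum (fun a b ↦ c * f a b) N = c * hyperbolaSum f N := by
  simp [hyperbolaSum, Finset.mul_sum]

theorem hyperbolaSum_zero_right (f : ℕ → ℕ → ℝ) : hyperbolaSum f 0 = 0 := by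
  simp [hyperbolaSum]

/-- The weight `d(n) / n`. -/
noncomputable def divWeight (n : ℕ) : ℝ := n.divisors.card / n

/-- The weight `d(n) log n / n`. -/
noncomputable def divLogWeight (n : ℕ) : ℝ := divWeight n * Real.log n

theorem divWeight_nonneg (n : ℕ) : 0 ≤ divWeight n := by
  unfold divWeight
  positivity

theorem divLogWeight_nonneg (n : ℕ) : 0 ≤ divLogWeight n :=
  mul_nonneg (divWeight_nonneg n) (Real.log_natCast_nonneg n)

theorem divWeight_eq_sum (n : ℕ) :
    divWeight n = ∑ x ∈ n.divisorsAntidiagonal, (x.1 : ℝ)⁻¹ * (x.2 : ℝ)⁻¹ := by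
  rw [divWeight, ← card_divisorsAntidiagonal_eq, div_eq_mul_inv, ← nsmul_eq_mul,
    ← Finset.sum_const]
  refine Finset.sum_congr rfl fun x hx ↦ ?_
  rw [← (Nat.mem_divisorsAntidiagonal.mp hx).1, Nat.cast_mul, mul_inv]

theorem hasLogMean_divWeight : HasLogMean divWeight (1 / 2) 1 := by
  obtain ⟨K, hK⟩ := hasLogMean_inv.hyperbolaSum (fun n ↦ by positivity) hasLogMean_inv
  refine ⟨K, fun y hy ↦ ?_⟩
  have h := hK y hy
  rw [← sum_divisorsAntidiagonal_eq_hyperbolaSum] at h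
  simp only [← divWeight_eq_sum] at h
  norm_num [rieszConst] at h ⊢
  exact h

theorem hasLogMean_divLogWeight : HasLogMean divLogWeight (1 / 3) 2 := by
  have h := hasLogMean_divWeight.mul_log
  norm_num [rieszConst] at h ⊢
  exact h

theorem hyperbolaSum_divWeight_divWeight_le :
    ∃ K : ℝ, 0 ≤ K ∧ ∀ y : ℝ, 0 ≤ y →
      |hyperbolaSum (fun a b ↦ divWeight a * divWeight b) ⌊Real.exp y⌋₊| ≤ K * (1 + y) ^ 4 := by
  obtain ⟨K, hK⟩ := hasLogMean_divWeight.hyperbolaSum divWeight_nonneg hasLogMean_divWeight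
  have hK0 : 0 ≤ K := by simpa using (abs_nonneg _).trans (hK 0 le_rfl)
  refine ⟨K + 1 / 24, by positivity, fun y hy ↦ ?_⟩
  have h := hK y hy
  norm_num [rieszConst] at h
  have h1 : (1 + y) ^ 3 ≤ (1 + y) ^ 4 := pow_le_pow_right₀ (by linarith) (by norm_num)
  have h2 : y ^ 4 ≤ (1 + y) ^ 4 := by
    gcongr
    linarith
  have h3 := mul_le_mul_of_nonneg_left h1 hK0
  have h4 := pow_nonneg hy 4
  rw [abs_le] at h ⊢
  constructor <;> linarith

/-- The sum of `d(ab) (log a + log b) / (ab)` over `ab ≤ x`. -/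
theorem hyperbolaSum_divisors_log_add_log :
    ∃ K : ℝ, ∀ y : ℝ, 0 ≤ y →
      |hyperbolaSum (fun a b ↦ ((a * b).divisors.card : ℝ) *
          ((Real.log a + Real.log b) / (a * b))) ⌊Real.exp y⌋₊ -
        6 / Real.pi ^ 2 * (1 / 30) * y ^ 5| ≤ K * (1 + y) ^ 4 := by
  obtain ⟨K₁, hK₁⟩ :=
    hasLogMean_divLogWeight.hyperbolaSum divLogWeight_nonneg hasLogMean_divWeight
  obtain ⟨K₂, hK₂⟩ :=
    hasLogMean_divWeight.hyperbolaSum divWeight_nonneg hasLogMean_divLogWeight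
  obtain ⟨K₃, hK₃0, hK₃⟩ := hyperbolaSum_divWeight_divWeight_le
  have hK₁0 : 0 ≤ K₁ := by simpa using (abs_nonneg _).trans (hK₁ 0 le_rfl)
  have hK₂0 : 0 ≤ K₂ := by simpa using (abs_nonneg _).trans (hK₂ 0 le_rfl)
  obtain ⟨K, hK⟩ := sum_moebius_div_sq_mul (D := 1 / 30) (K := K₁ + K₂ + 2 * K₃) (j := 4)
    (H := fun e M ↦ hyperbolaSum (fun a b ↦ divLogWeight a * divWeight b) M +
      hyperbolaSum (fun a b ↦ divWeight a * divLogWeight b) M +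
      2 * Real.log e * hyperbolaSum (fun a b ↦ divWeight a * divWeight b) M)
    (fun e ↦ by simp [hyperbolaSum_zero_right]) (fun e he z hz ↦ by
      have h1 := hK₁ z hz
      have h2 := hK₂ z hz
      have h3 := hK₃ z hz
      norm_num [rieszConst] at h1 h2 ⊢
      have hl := Real.log_natCast_nonneg e
      have hP : 0 ≤ (1 + z) ^ 4 := by positivity
      have h4 := mul_le_mul_of_nonneg_left h3 (by positivity : 0 ≤ 2 * Real.log e)
      have h5 : K₁ + K₂ + 2 * Real.log e * K₃ ≤ (K₁ + K₂ + 2 * K₃) * (1 + Real.log e) ^ 2 := by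
        have : 0 ≤ (K₁ + K₂ + 2 * K₃) * (1 + Real.log e + Real.log e ^ 2) := by positivity
        nlinarith [mul_nonneg hK₁0 hl, mul_nonneg hK₂0 hl, mul_nonneg hK₃0 hl]
      have h6 := mul_le_mul_of_nonneg_right h5 hP
      rw [← abs_of_nonneg (by positivity : 0 ≤ 2 * Real.log e), ← abs_mul,
        abs_of_nonneg (by positivity : 0 ≤ 2 * Real.log e)] at h4
      rw [abs_le] at h1 h2 h4 ⊢
      constructor <;> linarith)
  refine ⟨K, fun y hy ↦ ?_⟩
  convert hK y hy using 3
  rw [hyperbolaSum_card_divisors_mul]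
  refine Finset.sum_congr rfl fun e he ↦ ?_
  have he0 : (e : ℝ) ≠ 0 := by
    have := (Finset.mem_Icc.mp he).1
    positivity
  rw [div_mul_eq_mul_div, mul_div_assoc]
  congr 1
  rw [div_eq_inv_mul, ← hyperbolaSum_const_mul, ← hyperbolaSum_add, ← hyperbolaSum_add,
    ← hyperbolaSum_const_mul]
  refine hyperbolaSum_congr _ fun a b ha hb ↦ ?_
  have ha0 : (a : ℝ) ≠ 0 := by positivity
  have hb0 : (b : ℝ) ≠ 0 := by positivity
  push_cast
  rw [Real.log_mul he0 ha0, Real.log_mul he0 hb0]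
  unfold divLogWeight divWeight
  field_simp
  ring

/-- The sum of `d(ab) log a log b / (ab)` over `ab ≤ x`. -/
theorem hyperbolaSum_divisors_log_mul_log :
    ∃ K : ℝ, ∀ y : ℝ, 0 ≤ y →
      |hyperbolaSum (fun a b ↦ ((a * b).divisors.card : ℝ) *
          (Real.log a * Real.log b / (a * b))) ⌊Real.exp y⌋₊ -
        6 / Real.pi ^ 2 * (1 / 180) * y ^ 6| ≤ K * (1 + y) ^ 5 := by
  obtain ⟨K₀, hK₀⟩ :=
    hasLogMean_divLogWeight.hyperbolaSum divLogWeight_nonneg hasLogMean_divLogWeight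
  obtain ⟨K₁, hK₁⟩ :=
    hasLogMean_divLogWeight.hyperbolaSum divLogWeight_nonneg hasLogMean_divWeight
  obtain ⟨K₂, hK₂⟩ :=
    hasLogMean_divWeight.hyperbolaSum divWeight_nonneg hasLogMean_divLogWeight
  obtain ⟨K₃, hK₃0, hK₃⟩ := hyperbolaSum_divWeight_divWeight_le
  have hK₀0 : 0 ≤ K₀ := by simpa using (abs_nonneg _).trans (hK₀ 0 le_rfl)
  have hK₁0 : 0 ≤ K₁ := by simpa using (abs_nonneg _).trans (hK₁ 0 le_rfl)
  have hK₂0 : 0 ≤ K₂ := by simpa using (abs_nonneg _).trans (hK₂ 0 le_rfl)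
  obtain ⟨K, hK⟩ := sum_moebius_div_sq_mul (D := 1 / 180) (K := K₀ + (K₁ + K₂ + 1) + K₃) (j := 5)
    (H := fun e M ↦ hyperbolaSum (fun a b ↦ divLogWeight a * divLogWeight b) M +
      Real.log e * (hyperbolaSum (fun a b ↦ divLogWeight a * divWeight b) M +
        hyperbolaSum (fun a b ↦ divWeight a * divLogWeight b) M) +
      Real.log e ^ 2 * hyperbolaSum (fun a b ↦ divWeight a * divWeight b) M)
    (fun e ↦ by simp [hyperbolaSum_zero_right]) (fun e he z hz ↦ by
      have h0 := hK₀ z hz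
      have h1 := hK₁ z hz
      have h2 := hK₂ z hz
      have h3 := hK₃ z hz
      norm_num [rieszConst] at h0 h1 h2 ⊢
      have hl := Real.log_natCast_nonneg e
      have hP : 0 ≤ (1 + z) ^ 5 := by positivity
      have hP4 : (1 + z) ^ 4 ≤ (1 + z) ^ 5 := pow_le_pow_right₀ (by linarith) (by norm_num)
      have hz5 : z ^ 5 ≤ (1 + z) ^ 5 := by
        gcongr
        linarith
      have hz50 := pow_nonneg hz 5
      have hm1 := mul_le_mul_of_nonneg_left hP4 hK₁0
      have hm2 := mul_le_mul_of_nonneg_left hP4 hK₂0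
      have hm3 := mul_le_mul_of_nonneg_left hP4 hK₃0
      set A := hyperbolaSum (fun a b ↦ divLogWeight a * divWeight b) ⌊Real.exp z⌋₊ +
        hyperbolaSum (fun a b ↦ divWeight a * divLogWeight b) ⌊Real.exp z⌋₊ with hA
      have h4 : |A| ≤ (K₁ + K₂ + 1) * (1 + z) ^ 5 := by
        rw [abs_le] at h1 h2 ⊢
        constructor <;> linarith
      have h5 := mul_le_mul_of_nonneg_left h4 hl
      have h6 := mul_le_mul_of_nonneg_left (h3.trans hm3) (sq_nonneg (Real.log e))
      have hs : K₀ + Real.log e * (K₁ + K₂ + 1) + Real.log e ^ 2 * K₃ ≤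
          (K₀ + (K₁ + K₂ + 1) + K₃) * (1 + Real.log e) ^ 2 := by
        have e1 : 1 ≤ (1 + Real.log e) ^ 2 := by nlinarith
        have e2 : Real.log e ≤ (1 + Real.log e) ^ 2 := by nlinarith
        have e3 : Real.log e ^ 2 ≤ (1 + Real.log e) ^ 2 := by nlinarith
        nlinarith [mul_le_mul_of_nonneg_left e1 hK₀0,
          mul_le_mul_of_nonneg_left e2 (by positivity : 0 ≤ K₁ + K₂ + 1),
          mul_le_mul_of_nonneg_left e3 hK₃0]
      have h7 := mul_le_mul_of_nonneg_right hs hP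
      rw [← abs_of_nonneg hl, ← abs_mul, abs_of_nonneg hl] at h5
      rw [← abs_of_nonneg (sq_nonneg (Real.log e)), ← abs_mul,
        abs_of_nonneg (sq_nonneg (Real.log e))] at h6
      rw [abs_le] at h0 h5 h6 ⊢
      constructor <;> linarith)
  refine ⟨K, fun y hy ↦ ?_⟩
  convert hK y hy using 3
  rw [hyperbolaSum_card_divisors_mul]
  refine Finset.sum_congr rfl fun e he ↦ ?_
  have he0 : (e : ℝ) ≠ 0 := by
    have := (Finset.mem_Icc.mp he).1
    positivity
  rw [div_mul_eq_mul_div, mul_div_assoc]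
  congr 1
  rw [div_eq_inv_mul, ← hyperbolaSum_const_mul, ← hyperbolaSum_add, ← hyperbolaSum_const_mul,
    ← hyperbolaSum_add, ← hyperbolaSum_add, ← hyperbolaSum_const_mul]
  refine hyperbolaSum_congr _ fun a b ha hb ↦ ?_
  have ha0 : (a : ℝ) ≠ 0 := by positivity
  have hb0 : (b : ℝ) ≠ 0 := by positivity
  push_cast
  rw [Real.log_mul he0 ha0, Real.log_mul he0 hb0]
  unfold divLogWeight divWeight
  field_simp
  ring

theorem sum_card_divisors_sq_div_le (N : ℕ) :
    ∑ n ∈ Finset.Icc 1 N, (n.divisors.card : ℝ) ^ 2 / n ≤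
      hyperbolaSum (fun a b ↦ divWeight a * divWeight b) N := by
  have h : ∀ n ∈ Finset.Icc 1 N, (n.divisors.card : ℝ) ^ 2 / n =
      ∑ x ∈ n.divisorsAntidiagonal,
        ((x.1 * x.2).divisors.card : ℝ) * ((x.1 : ℝ)⁻¹ * (x.2 : ℝ)⁻¹) := by
    intro n _
    rw [sq, mul_div_assoc]
    change _ * divWeight n = _
    rw [divWeight_eq_sum, Finset.mul_sum]
    exact Finset.sum_congr rfl fun x hx ↦ by rw [(Nat.mem_divisorsAntidiagonal.mp hx).1]
  rw [Finset.sum_congr rfl h, sum_divisorsAntidiagonal_eq_hyperbolaSum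
    (fun a b ↦ ((a * b).divisors.card : ℝ) * ((a : ℝ)⁻¹ * (b : ℝ)⁻¹))]
  refine hyperbolaSum_mono _ fun a b ha hb ↦ ?_
  have h1 : ((a * b).divisors.card : ℝ) ≤ a.divisors.card * b.divisors.card := by
    exact_mod_cast card_divisors_mul_le (Nat.ne_zero_of_lt ha) (Nat.ne_zero_of_lt hb)
  calc _ ≤ (a.divisors.card * b.divisors.card : ℝ) * ((a : ℝ)⁻¹ * (b : ℝ)⁻¹) := by gcongr
    _ = _ := by
        unfold divWeight
        ring

theorem card_divisors_prime_mul_le {p n : ℕ} (hp : p.Prime) (hn : n ≠ 0) :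
    (((p * n).divisors.card : ℕ) : ℝ) ≤ 2 * n.divisors.card := by
  have h := card_divisors_mul_le hp.ne_zero hn
  have h2 : p.divisors.card = 2 := by
    rw [hp.divisors, Finset.card_pair hp.one_lt.ne]
  rw [h2] at h
  exact_mod_cast h

/-- The multiples of `p` contribute little to `∑ d(n)² / n`. -/
theorem sum_multiples_card_divisors_sq_div_le {p : ℕ} (hp : p.Prime) (N : ℕ) :
    ∑ n ∈ Finset.Icc 1 N with p ∣ n, (n.divisors.card : ℝ) ^ 2 / n ≤
      4 / p * ∑ n ∈ Finset.Icc 1 N, (n.divisors.card : ℝ) ^ 2 / n := by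
  have h : ∑ n ∈ Finset.Icc 1 N with p ∣ n, (n.divisors.card : ℝ) ^ 2 / n =
      ∑ m ∈ Finset.Icc 1 (N / p), ((p * m).divisors.card : ℝ) ^ 2 / ((p * m : ℕ) : ℝ) := by
    symm
    refine Finset.sum_bij' (fun m _ ↦ p * m) (fun n _ ↦ n / p) ?_ ?_ ?_ ?_ ?_
    · intro m hm
      rw [Finset.mem_Icc, Nat.le_div_iff_mul_le hp.pos, mul_comm] at hm
      rw [Finset.mem_filter, Finset.mem_Icc]
      exact ⟨⟨Nat.mul_pos hp.pos hm.1, hm.2⟩, dvd_mul_right _ _⟩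
    · intro n hn
      rw [Finset.mem_filter, Finset.mem_Icc] at hn
      rw [Finset.mem_Icc]
      exact ⟨Nat.div_pos (Nat.le_of_dvd hn.1.1 hn.2) hp.pos, Nat.div_le_div_right hn.1.2⟩
    · intro m _
      exact Nat.mul_div_cancel_left m hp.pos
    · intro n hn
      exact Nat.mul_div_cancel' (Finset.mem_filter.mp hn).2
    · intro m _
      rfl
  rw [h, Finset.mul_sum]
  refine (Finset.sum_le_sum fun m hm ↦ ?_).trans (Finset.sum_le_sum_of_subset_of_nonneg
    (Finset.Icc_subset_Icc_right (Nat.div_le_self N p)) fun _ _ _ ↦ by positivity)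
  have h1 := card_divisors_prime_mul_le hp (Nat.ne_zero_of_lt (Finset.mem_Icc.mp hm).1)
  calc _ ≤ (2 * (m.divisors.card : ℝ)) ^ 2 / ((p * m : ℕ) : ℝ) := by gcongr
    _ = _ := by
        push_cast
        rw [mul_pow, div_mul_div_comm]
        norm_num

/-- For `p ∣ n` the value `α(pn)` is not far from what it would be for `p ∤ n`. -/
theorem abs_alphaFn_sub_le {p n : ℕ} {y : ℝ} (hp : p.Prime) (hn : n ≠ 0)
    (hpy : Real.log p ≤ y) (hny : Real.log n ≤ y) :
    |alphaFn (p * n) - ∑ x ∈ n.divisorsAntidiagonal,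
      (2 * (Real.log x.1 * Real.log x.2) + Real.log p * (Real.log x.1 + Real.log x.2))| ≤
      8 * y ^ 2 * n.divisors.card := by
  have hp0 := Real.log_natCast_nonneg p
  have hpr : (p : ℝ) ≠ 0 := by exact_mod_cast hp.ne_zero
  have hnr : (n : ℝ) ≠ 0 := by exact_mod_cast hn
  have h1 : alphaFn (p * n) ≤ 8 * y ^ 2 * n.divisors.card := by
    refine (alphaFn_le (mul_ne_zero hp.ne_zero hn)).trans ?_
    have h2 : Real.log ((p * n : ℕ) : ℝ) ≤ 2 * y := by
      push_cast
      rw [Real.log_mul hpr hnr]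
      linarith
    have h3 := Real.log_natCast_nonneg (p * n)
    calc _ ≤ (2 * (n.divisors.card : ℝ)) * (2 * y) ^ 2 := by
          gcongr
          exact card_divisors_prime_mul_le hp hn
      _ = _ := by ring
  have hx : ∀ x ∈ n.divisorsAntidiagonal,
      (0 ≤ Real.log x.1 ∧ Real.log x.1 ≤ y) ∧ 0 ≤ Real.log x.2 ∧ Real.log x.2 ≤ y := by
    intro x hx
    have h := (Nat.mem_divisorsAntidiagonal.mp hx).1
    have h1 := log_mem_Icc_of_dvd hn (h ▸ dvd_mul_right x.1 x.2)
    have h2 := log_mem_Icc_of_dvd hn (h ▸ dvd_mul_left x.2 x.1)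
    exact ⟨⟨h1.1, h1.2.trans hny⟩, h2.1, h2.2.trans hny⟩
  have h2 : ∑ x ∈ n.divisorsAntidiagonal,
      (2 * (Real.log x.1 * Real.log x.2) + Real.log p * (Real.log x.1 + Real.log x.2)) ≤
      8 * y ^ 2 * n.divisors.card := by
    rw [mul_comm, ← card_divisorsAntidiagonal_eq, ← nsmul_eq_mul]
    refine Finset.sum_le_card_nsmul _ _ _ fun x hx' ↦ ?_
    obtain ⟨⟨ha, ha'⟩, hb, hb'⟩ := hx x hx'
    nlinarith [mul_le_mul ha' hb' hb (ha.trans ha'), mul_le_mul hpy ha' ha (hp0.trans hpy),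
      mul_le_mul hpy hb' hb (hp0.trans hpy), sq_nonneg y]
  have h3 : 0 ≤ ∑ x ∈ n.divisorsAntidiagonal,
      (2 * (Real.log x.1 * Real.log x.2) + Real.log p * (Real.log x.1 + Real.log x.2)) := by
    refine Finset.sum_nonneg fun x hx' ↦ ?_
    obtain ⟨⟨ha, _⟩, hb, _⟩ := hx x hx'
    positivity
  have h4 := alphaFn_nonneg (p * n)
  rw [abs_le]
  constructor <;> linarith

theorem abs_sum_alphaFn_sub_hyperbolaSum_le {p : ℕ} {y : ℝ} (hp : p.Prime)
    (hpy : Real.log p ≤ y) :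
    |∑ n ∈ Finset.Icc 1 ⌊Real.exp y⌋₊, (n.divisors.card : ℝ) * alphaFn (p * n) / n -
      (2 * hyperbolaSum (fun a b ↦ ((a * b).divisors.card : ℝ) *
          (Real.log a * Real.log b / (a * b))) ⌊Real.exp y⌋₊ +
        Real.log p * hyperbolaSum (fun a b ↦ ((a * b).divisors.card : ℝ) *
          ((Real.log a + Real.log b) / (a * b))) ⌊Real.exp y⌋₊)| ≤
      32 * y ^ 2 / p * hyperbolaSum (fun a b ↦ divWeight a * divWeight b) ⌊Real.exp y⌋₊ := by
  set N := ⌊Real.exp y⌋₊ with hN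
  have hmain : 2 * hyperbolaSum (fun a b ↦ ((a * b).divisors.card : ℝ) *
          (Real.log a * Real.log b / (a * b))) N +
        Real.log p * hyperbolaSum (fun a b ↦ ((a * b).divisors.card : ℝ) *
          ((Real.log a + Real.log b) / (a * b))) N =
      ∑ n ∈ Finset.Icc 1 N, (n.divisors.card : ℝ) * (∑ x ∈ n.divisorsAntidiagonal,
        (2 * (Real.log x.1 * Real.log x.2) + Real.log p * (Real.log x.1 + Real.log x.2))) / n := by
    rw [← hyperbolaSum_const_mul, ← hyperbolaSum_const_mul, ← hyperbolaSum_add,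
      ← sum_divisorsAntidiagonal_eq_hyperbolaSum]
    refine Finset.sum_congr rfl fun n _ ↦ ?_
    rw [Finset.mul_sum, Finset.sum_div]
    refine Finset.sum_congr rfl fun x hx ↦ ?_
    rw [← (Nat.mem_divisorsAntidiagonal.mp hx).1]
    push_cast
    ring
  rw [hmain, ← Finset.sum_sub_distrib]
  refine (Finset.abs_sum_le_sum_abs _ _).trans ?_
  calc _ ≤ ∑ n ∈ Finset.Icc 1 N,
        if p ∣ n then 8 * y ^ 2 * ((n.divisors.card : ℝ) ^ 2 / n) else 0 := by
        refine Finset.sum_le_sum fun n hn ↦ ?_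
        have hn' := mem_Icc_floor_exp.mp hn
        have hn0 : n ≠ 0 := Nat.ne_zero_of_lt hn'.1
        split_ifs with hpn
        · rw [← sub_div, ← mul_sub, abs_div, abs_mul, Nat.abs_cast, Nat.abs_cast]
          have h := abs_alphaFn_sub_le hp hn0 hpy hn'.2
          calc _ ≤ (n.divisors.card : ℝ) * (8 * y ^ 2 * n.divisors.card) / n := by gcongr
            _ = _ := by ring
        · rw [alphaFn_prime_mul hp hpn, sub_self, abs_zero]
    _ = 8 * y ^ 2 * ∑ n ∈ Finset.Icc 1 N with p ∣ n, (n.divisors.card : ℝ) ^ 2 / n := by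
        rw [← Finset.sum_filter, Finset.mul_sum]
    _ ≤ 8 * y ^ 2 * (4 / p * hyperbolaSum (fun a b ↦ divWeight a * divWeight b) N) := by
        refine mul_le_mul_of_nonneg_left ?_ (by positivity)
        refine (sum_multiples_card_divisors_sq_div_le hp N).trans ?_
        exact mul_le_mul_of_nonneg_left (sum_card_divisors_sq_div_le N) (by positivity)
    _ = _ := by ring

theorem d_alpha_shifted_sum :
    ∃ K : ℝ, 0 < K ∧ ∀ t : ℝ, 3 ≤ t → ∀ p : ℕ, p.Prime → (p : ℝ) ≤ t →
      |(∑ n ∈ Finset.Icc 1 ⌊t⌋₊, (n.divisors.card : ℝ) * alphaFn (p * n) / n) -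
          6 / Real.pi ^ 2 *
            (1 / 90 * Real.log t ^ 6 + 1 / 30 * Real.log t ^ 5 * Real.log p)|
        ≤ K * (Real.log t ^ 5 + Real.log t ^ 6 / p) := by
  obtain ⟨K₁, hK₁⟩ := hyperbolaSum_divisors_log_mul_log
  obtain ⟨K₂, hK₂⟩ := hyperbolaSum_divisors_log_add_log
  obtain ⟨K₃, hK₃0, hK₃⟩ := hyperbolaSum_divWeight_divWeight_le
  have hK₁0 : 0 ≤ K₁ := by simpa using (abs_nonneg _).trans (hK₁ 0 le_rfl)
  have hK₂0 : 0 ≤ K₂ := by simpa using (abs_nonneg _).trans (hK₂ 0 le_rfl)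
  refine ⟨64 * K₁ + 16 * K₂ + 512 * K₃ + 1, by positivity, fun t ht p hp hpt ↦ ?_⟩
  have ht0 : 0 < t := by linarith
  have hp0 : (0 : ℝ) < p := by exact_mod_cast hp.pos
  set y := Real.log t with hy
  have hexp : t = Real.exp y := (Real.exp_log ht0).symm
  have hy1 : 1 ≤ y := by
    rw [hy, Real.le_log_iff_exp_le ht0]
    linarith [Real.exp_one_lt_d9]
  have hpy : Real.log p ≤ y := Real.log_le_log hp0 hpt
  have hlp := Real.log_natCast_nonneg p
  have h1 := hK₁ y (by linarith)
  have h2 := mul_le_mul_of_nonneg_left (hK₂ y (by linarith)) hlp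
  have h3 := hK₃ y (by linarith)
  have h4 := abs_sum_alphaFn_sub_hyperbolaSum_le hp hpy
  rw [hexp]
  set A := hyperbolaSum (fun a b ↦ ((a * b).divisors.card : ℝ) *
    (Real.log a * Real.log b / (a * b))) ⌊Real.exp y⌋₊
  set B := hyperbolaSum (fun a b ↦ ((a * b).divisors.card : ℝ) *
    ((Real.log a + Real.log b) / (a * b))) ⌊Real.exp y⌋₊
  set C := hyperbolaSum (fun a b ↦ divWeight a * divWeight b) ⌊Real.exp y⌋₊
  set S := ∑ n ∈ Finset.Icc 1 ⌊Real.exp y⌋₊, (n.divisors.card : ℝ) * alphaFn (p * n) / n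
  have h5 : K₁ * (1 + y) ^ 5 ≤ 32 * K₁ * y ^ 5 := by
    calc _ ≤ K₁ * (2 * y) ^ 5 := by
          gcongr
          linarith
      _ = _ := by ring
  have h6 : Real.log p * (K₂ * (1 + y) ^ 4) ≤ 16 * K₂ * y ^ 5 := by
    calc _ ≤ y * (K₂ * (2 * y) ^ 4) := by
          gcongr
          linarith
      _ = _ := by ring
  have h7 : 32 * y ^ 2 / p * C ≤ 512 * K₃ * (y ^ 6 / p) := by
    calc _ ≤ 32 * y ^ 2 / p * (K₃ * (2 * y) ^ 4) := by
          refine mul_le_mul_of_nonneg_left ?_ (by positivity)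
          refine (le_abs_self C).trans (h3.trans ?_)
          gcongr
          linarith
      _ = _ := by ring
  have h8 : 0 ≤ y ^ 5 := by positivity
  have h9 : 0 ≤ y ^ 6 / p := by positivity
  have h10 : 0 ≤ K₁ * (y ^ 6 / p) := by positivity
  have h11 : 0 ≤ K₂ * (y ^ 6 / p) := by positivity
  have h12 : 0 ≤ K₃ * y ^ 5 := by positivity
  rw [← abs_of_nonneg hlp, ← abs_mul, abs_of_nonneg hlp] at h2
  rw [abs_le] at h1 h2 h4 ⊢
  constructor <;> nlinarith
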